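/- arXiv:1109.1287 — 2 statements merged into one kernel-verified Lean document; each statement's English description precedes it below -/
import Mathlib

section
/- For every b ≥ 1 and every R > 0, m₀(b,R) = 0. Moreover, for every b ∈ [0,∞) the limit g(b) := lim_{R→∞} m₀(b,R)/R² exists, and g(b) ≤ 0. -/
open MeasureTheory Filter Set

noncomputable section

/-- The canonical 2D magnetic potential `A₀(x) = (-x₂/2, x₁/2)`. -/
def A0 (x : ℝ × ℝ) : ℝ × ℝ := (-x.2 / 2, x.1 / 2)

/-- The open square `K_R = (-R/2, R/2) × (-R/2, R/2)` in `ℝ²`. -/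
def KR (R : ℝ) : Set (ℝ × ℝ) := Ioo (-R/2) (R/2) ×ˢ Ioo (-R/2) (R/2)

/-- First component of the magnetic gradient `(∇ - iA₀)u`. -/
def D1 (u : ℝ × ℝ → ℂ) (x : ℝ × ℝ) : ℂ :=
  fderiv ℝ u x (1, 0) - Complex.I * ((A0 x).1 : ℂ) * u x

/-- Second component of the magnetic gradient `(∇ - iA₀)u`. -/
def D2 (u : ℝ × ℝ → ℂ) (x : ℝ × ℝ) : ℂ :=
  fderiv ℝ u x (0, 1) - Complex.I * ((A0 x).2 : ℂ) * u x

/-- The two-dimensional Ginzburg–Landau energy `G_{b,K_R}(u)`. -/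
def G2 (b R : ℝ) (u : ℝ × ℝ → ℂ) : ℝ :=
  ∫ x in KR R, (b * (‖D1 u x‖ ^ 2 + ‖D2 u x‖ ^ 2) - ‖u x‖ ^ 2 + (1/2) * ‖u x‖ ^ 4)

/-- `m₀(b,R)`: the ground state energy of `G_{b,K_R}` with Dirichlet boundary conditions,
realized (by density) as the infimum over smooth functions compactly supported in `K_R`. -/
def m0 (b R : ℝ) : ℝ :=
  sInf {E : ℝ | ∃ u : ℝ × ℝ → ℂ, ContDiff ℝ (⊤ : ℕ∞) u ∧ HasCompactSupport u ∧
    tsupport u ⊆ KR R ∧ E = G2 b R u}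

/-- The magnetic periodicity conditions defining the space `E_R`. -/
def MagPeriodic (R : ℝ) (u : ℝ × ℝ → ℂ) : Prop :=
  ∀ x : ℝ × ℝ,
    u (x.1 + R, x.2) = Complex.exp (Complex.I * (R * x.2 / 2)) * u x ∧
    u (x.1, x.2 + R) = Complex.exp (-(Complex.I * (R * x.1 / 2))) * u x

/-- `m_p(b,R)`: the ground state energy of `G_{b,K_R}` over the magnetically periodic space
`E_R`, realized (by elliptic regularity/density) over smooth magnetic periodic functions. -/
def mp (b R : ℝ) : ℝ :=
  sInf {E : ℝ | ∃ u : ℝ × ℝ → ℂ, ContDiff ℝ (⊤ : ℕ∞) u ∧ MagPeriodic R u ∧ E = G2 b R u}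

/-- The lowest Landau band equation `(∂₁ + i∂₂ + (1/2)(x₁ + ix₂))u = 0`. -/
def LLL (u : ℝ × ℝ → ℂ) : Prop :=
  ∀ x : ℝ × ℝ,
    fderiv ℝ u x (1, 0) + Complex.I * fderiv ℝ u x (0, 1)
      + (1/2 : ℂ) * ((x.1 : ℂ) + Complex.I * (x.2 : ℂ)) * u x = 0

/-- The Abrikosov energy `F_R(v) = ∫_{K_R} (-|v|² + (1/2)|v|⁴)`. -/
def FAb (R : ℝ) (v : ℝ × ℝ → ℂ) : ℝ :=
  ∫ x in KR R, (-‖v x‖ ^ 2 + (1/2) * ‖v x‖ ^ 4)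

/-- `c(R)`: the minimal Abrikosov energy over the lowest Landau band `L_R`. -/
def cAb (R : ℝ) : ℝ :=
  sInf {E : ℝ | ∃ u : ℝ × ℝ → ℂ, ContDiff ℝ (⊤ : ℕ∞) u ∧ MagPeriodic R u ∧ LLL u ∧ E = FAb R u}

/-- The thermodynamic limit function `g(b) = lim_{R→∞} m₀(b,R)/R²`. -/
def gfun (b : ℝ) : ℝ := limUnder atTop (fun R : ℝ => m0 b R / R ^ 2)

/-- The canonical 3D magnetic potential `F(x) = (-x₂/2, x₁/2, 0)`. -/
def Fpot (x : ℝ × ℝ × ℝ) : ℝ × ℝ × ℝ := (-x.2.1 / 2, x.1 / 2, 0)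

/-- The open cube `Q_R = (-R/2, R/2)³` in `ℝ³`. -/
def QR (R : ℝ) : Set (ℝ × ℝ × ℝ) :=
  Ioo (-R/2) (R/2) ×ˢ Ioo (-R/2) (R/2) ×ˢ Ioo (-R/2) (R/2)

/-- First component of the 3D magnetic gradient `(∇ - iF)u`. -/
def DD1 (u : ℝ × ℝ × ℝ → ℂ) (x : ℝ × ℝ × ℝ) : ℂ :=
  fderiv ℝ u x (1, 0, 0) - Complex.I * ((Fpot x).1 : ℂ) * u x

/-- Second component of the 3D magnetic gradient `(∇ - iF)u`. -/
def DD2 (u : ℝ × ℝ × ℝ → ℂ) (x : ℝ × ℝ × ℝ) : ℂ :=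
  fderiv ℝ u x (0, 1, 0) - Complex.I * ((Fpot x).2.1 : ℂ) * u x

/-- Third component of the 3D magnetic gradient `(∇ - iF)u`. -/
def DD3 (u : ℝ × ℝ × ℝ → ℂ) (x : ℝ × ℝ × ℝ) : ℂ :=
  fderiv ℝ u x (0, 0, 1) - Complex.I * ((Fpot x).2.2 : ℂ) * u x

/-- The three-dimensional Ginzburg–Landau energy `F³ᴰ_{b,Q_R}(u)`. -/
def G3 (b R : ℝ) (u : ℝ × ℝ × ℝ → ℂ) : ℝ :=
  ∫ x in QR R, (b * (‖DD1 u x‖ ^ 2 + ‖DD2 u x‖ ^ 2 + ‖DD3 u x‖ ^ 2)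
    - ‖u x‖ ^ 2 + (1/2) * ‖u x‖ ^ 4)

/-- `M₀(b,R)`: the 3D ground state energy with Dirichlet boundary conditions. -/
def M0 (b R : ℝ) : ℝ :=
  sInf {E : ℝ | ∃ u : ℝ × ℝ × ℝ → ℂ, ContDiff ℝ (⊤ : ℕ∞) u ∧ HasCompactSupport u ∧
    tsupport u ⊆ QR R ∧ E = G3 b R u}

end

/-- The admissible class of test functions on the square `K_R`. -/
def IsTestFun (R : ℝ) (u : ℝ × ℝ → ℂ) : Prop :=
  ContDiff ℝ (⊤ : ℕ∞) u ∧ HasCompactSupport u ∧ tsupport u ⊆ KR R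

/-- The Ginzburg–Landau energy density. -/
noncomputable def glDensity (b : ℝ) (u : ℝ × ℝ → ℂ) (x : ℝ × ℝ) : ℝ :=
  b * (‖D1 u x‖ ^ 2 + ‖D2 u x‖ ^ 2) - ‖u x‖ ^ 2 + (1/2) * ‖u x‖ ^ 4

/-- The magnetic translate of `u` by `c`. -/
noncomputable def magTranslate (c : ℝ × ℝ) (u : ℝ × ℝ → ℂ) (x : ℝ × ℝ) : ℂ :=
  Complex.exp (((c.1 * x.2 - c.2 * x.1) / 2 : ℝ) * Complex.I) * u (x - c)

section Density

variable {b R : ℝ} {u v : ℝ × ℝ → ℂ} {x : ℝ × ℝ}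

lemma glDensity_congr (h : u =ᶠ[nhds x] v) : glDensity b u x = glDensity b v x := by
  simp only [glDensity, D1, D2, h.fderiv_eq, h.self_of_nhds]

lemma glDensity_zero : glDensity b 0 x = 0 := by
  have h : fderiv ℝ (0 : ℝ × ℝ → ℂ) x = 0 := by simp
  simp [glDensity, D1, D2, h]

lemma glDensity_eq_zero (h : x ∉ tsupport u) : glDensity b u x = 0 := by
  rw [glDensity_congr (notMem_tsupport_iff_eventuallyEq.mp h), glDensity_zero]

lemma continuous_glDensity (hu : ContDiff ℝ (⊤ : ℕ∞) u) : Continuous (glDensity b u) := by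
  have h0 := hu.continuous
  have h1 : Continuous (fderiv ℝ u) := hu.continuous_fderiv (by simp)
  unfold glDensity D1 D2 A0
  fun_prop

lemma hasCompactSupport_glDensity (hu : HasCompactSupport u) :
    HasCompactSupport (glDensity b u) :=
  HasCompactSupport.intro hu fun _ h => glDensity_eq_zero h

lemma integrable_glDensity (hu : ContDiff ℝ (⊤ : ℕ∞) u) (hc : HasCompactSupport u) :
    Integrable (glDensity b u) :=
  (continuous_glDensity hu).integrable_of_hasCompactSupport (hasCompactSupport_glDensity hc)

lemma G2_eq_integral (hu : tsupport u ⊆ KR R) : G2 b R u = ∫ x, glDensity b u x :=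
  setIntegral_eq_integral_of_forall_compl_eq_zero
    fun _ hx => glDensity_eq_zero fun h => hx (hu h)

lemma integral_glDensity_add (hu : ContDiff ℝ (⊤ : ℕ∞) u) (hcu : HasCompactSupport u)
    (hv : ContDiff ℝ (⊤ : ℕ∞) v) (hcv : HasCompactSupport v)
    (hd : Disjoint (tsupport u) (tsupport v)) :
    ∫ x, glDensity b (u + v) x = (∫ x, glDensity b u x) + ∫ x, glDensity b v x := by
  rw [← integral_add (integrable_glDensity hu hcu) (integrable_glDensity hv hcv)]
  congr 1 with x
  by_cases hx : x ∈ tsupport u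
  · have hxv := Set.disjoint_left.mp hd hx
    rw [glDensity_eq_zero hxv, add_zero]
    apply glDensity_congr
    filter_upwards [notMem_tsupport_iff_eventuallyEq.mp hxv] with y hy
    simp [hy]
  · rw [glDensity_eq_zero hx, zero_add]
    apply glDensity_congr
    filter_upwards [notMem_tsupport_iff_eventuallyEq.mp hx] with y hy
    simp [hy]

end Density

section Translate

variable {b : ℝ} {u : ℝ × ℝ → ℂ} {c : ℝ × ℝ}

lemma contDiff_magTranslate (hu : ContDiff ℝ (⊤ : ℕ∞) u) :
    ContDiff ℝ (⊤ : ℕ∞) (magTranslate c u) := by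
  have h1 : ContDiff ℝ (⊤ : ℕ∞) fun x : ℝ × ℝ => (c.1 * x.2 - c.2 * x.1) / 2 := by fun_prop
  have h2 : ContDiff ℝ (⊤ : ℕ∞) fun x : ℝ × ℝ =>
      (((c.1 * x.2 - c.2 * x.1) / 2 : ℝ) : ℂ) := Complex.ofRealCLM.contDiff.comp h1
  exact (h2.mul contDiff_const).cexp.mul (hu.comp (contDiff_id.sub contDiff_const))

lemma tsupport_magTranslate : tsupport (magTranslate c u) ⊆ (fun x => x - c) ⁻¹' tsupport u := by
  apply closure_minimal _ ((isClosed_tsupport u).preimage (by fun_prop))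
  intro x hx
  apply subset_tsupport u
  intro h
  exact hx (by simp [magTranslate, h])

lemma hasCompactSupport_magTranslate (hu : HasCompactSupport u) :
    HasCompactSupport (magTranslate c u) :=
  ((Homeomorph.subRight c).isCompact_preimage.mpr hu).of_isClosed_subset
    (isClosed_tsupport _) tsupport_magTranslate

lemma fderiv_magTranslate (hu : ContDiff ℝ (⊤ : ℕ∞) u) (x w : ℝ × ℝ) :
    fderiv ℝ (magTranslate c u) x w =
      Complex.exp (((c.1 * x.2 - c.2 * x.1) / 2 : ℝ) * Complex.I) *
        (fderiv ℝ u (x - c) w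
          + (((c.1 * w.2 - c.2 * w.1) / 2 : ℝ) : ℂ) * Complex.I * u (x - c)) := by
  have h1 : HasFDerivAt (fun x : ℝ × ℝ => (c.1 * x.2 - c.2 * x.1) / 2)
      ((1 / 2 : ℝ) • (c.1 • ContinuousLinearMap.snd ℝ ℝ ℝ
        - c.2 • ContinuousLinearMap.fst ℝ ℝ ℝ)) x := by
    have := (((hasFDerivAt_snd (𝕜 := ℝ) (p := x)).const_mul c.1).sub
      ((hasFDerivAt_fst (𝕜 := ℝ) (p := x)).const_mul c.2)).const_mul (1 / 2 : ℝ)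
    refine this.congr_of_eventuallyEq (Eventually.of_forall fun y => ?_)
    simp only [Pi.sub_apply]
    ring
  have h2 := ((Complex.ofRealCLM.hasFDerivAt.comp x h1).mul_const Complex.I).cexp
  have h3 : HasFDerivAt (fun y => u (y - c)) (fderiv ℝ u (x - c)) x := by
    have := ((hu.differentiable (by simp)) (x - c)).hasFDerivAt.comp x
      ((hasFDerivAt_id x).sub_const c)
    simpa [Function.comp_def] using this
  have h4 := h2.mul h3
  have h5 : HasFDerivAt (magTranslate c u) _ x := h4
  rw [h5.fderiv]
  simp
  ring

lemma glDensity_magTranslate (hu : ContDiff ℝ (⊤ : ℕ∞) u) (x : ℝ × ℝ) :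
    glDensity b (magTranslate c u) x = glDensity b u (x - c) := by
  have hn := Complex.norm_exp_ofReal_mul_I ((c.1 * x.2 - c.2 * x.1) / 2)
  have h1 : ‖D1 (magTranslate c u) x‖ = ‖D1 u (x - c)‖ := by
    rw [← one_mul ‖D1 u (x - c)‖, ← hn, ← norm_mul, D1, fderiv_magTranslate hu]
    congr 1
    simp only [D1, A0, magTranslate, Prod.fst_sub, Prod.snd_sub]
    push_cast
    ring
  have h2 : ‖D2 (magTranslate c u) x‖ = ‖D2 u (x - c)‖ := by
    rw [← one_mul ‖D2 u (x - c)‖, ← hn, ← norm_mul, D2, fderiv_magTranslate hu]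
    congr 1
    simp only [D2, A0, magTranslate, Prod.fst_sub, Prod.snd_sub]
    push_cast
    ring
  have h0 : ‖magTranslate c u x‖ = ‖u (x - c)‖ := by
    rw [magTranslate, norm_mul, hn, one_mul]
  simp only [glDensity, h0, h1, h2]

lemma integral_glDensity_magTranslate (hu : ContDiff ℝ (⊤ : ℕ∞) u) :
    ∫ x, glDensity b (magTranslate c u) x = ∫ x, glDensity b u x := by
  simp only [glDensity_magTranslate hu]
  exact integral_sub_right_eq_self (glDensity b u) c

end Translate

/-- Superposition of magnetic translates placed in pairwise disjoint cells. -/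
lemma exists_superposition {ι : Type*} {b : ℝ} {u : ℝ × ℝ → ℂ} {K : Set (ℝ × ℝ)}
    (hu : ContDiff ℝ (⊤ : ℕ∞) u) (hc : HasCompactSupport u) (hK : tsupport u ⊆ K)
    (c : ι → ℝ × ℝ) (hd : Pairwise fun i j => Disjoint {x | x - c i ∈ K} {x | x - c j ∈ K})
    (s : Finset ι) :
    ∃ w : ℝ × ℝ → ℂ, ContDiff ℝ (⊤ : ℕ∞) w ∧ HasCompactSupport w ∧
      tsupport w ⊆ ⋃ i ∈ s, {x | x - c i ∈ K} ∧
      ∫ x, glDensity b w x = s.card * ∫ x, glDensity b u x := by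
  classical
  induction s using Finset.induction_on with
  | empty =>
    refine ⟨0, contDiff_const, HasCompactSupport.zero, by simp [tsupport], ?_⟩
    simp [glDensity_zero]
  | insert i s hi ih =>
    obtain ⟨w, hw, hwc, hws, hwE⟩ := ih
    have ht : tsupport (magTranslate (c i) u) ⊆ {x | x - c i ∈ K} :=
      tsupport_magTranslate.trans fun x hx => hK hx
    have hdis : Disjoint (tsupport (magTranslate (c i) u)) (tsupport w) := by
      refine Disjoint.mono ht hws ?_
      simp only [Set.disjoint_iUnion_right]
      exact fun j hj => hd fun h => hi (h ▸ hj)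
    refine ⟨magTranslate (c i) u + w, (contDiff_magTranslate hu).add hw,
      (hasCompactSupport_magTranslate hc).add hwc, ?_, ?_⟩
    · refine (tsupport_add _ _).trans ?_
      rw [Finset.set_biUnion_insert]
      exact Set.union_subset_union ht hws
    · rw [integral_glDensity_add (contDiff_magTranslate hu) (hasCompactSupport_magTranslate hc)
        hw hwc hdis, integral_glDensity_magTranslate hu, hwE, Finset.card_insert_of_notMem hi]
      push_cast
      ring

section GroundState

variable {b R : ℝ}

lemma G2_zero : G2 b R 0 = 0 := by
  rw [G2_eq_integral (by simp [tsupport])]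
  simp [glDensity_zero]

lemma isTestFun_zero : IsTestFun R 0 :=
  ⟨contDiff_const, HasCompactSupport.zero, by simp [tsupport]⟩

lemma volume_real_KR (hR : 0 ≤ R) : volume.real (KR R) = R ^ 2 := by
  have h : R / 2 - -R / 2 = R := by ring
  rw [KR, Measure.volume_eq_prod, measureReal_prod_prod, Real.volume_real_Ioo_of_le (by linarith), h]
  ring

lemma measurableSet_KR : MeasurableSet (KR R) := measurableSet_Ioo.prod measurableSet_Ioo

lemma neg_half_le_G2 (hb : 0 ≤ b) (hR : 0 ≤ R) {u : ℝ × ℝ → ℂ} (hu : IsTestFun R u) :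
    -(1 / 2) * R ^ 2 ≤ G2 b R u := by
  have hfin : volume (KR R) ≠ ⊤ := by
    rw [KR, Measure.volume_eq_prod, Measure.prod_prod, Real.volume_Ioo]
    exact ENNReal.mul_ne_top ENNReal.ofReal_ne_top ENNReal.ofReal_ne_top
  have h : ∫ _ in KR R, (-(1 / 2) : ℝ) ≤ ∫ x in KR R, glDensity b u x := by
    refine setIntegral_mono_on (integrableOn_const hfin)
      (integrable_glDensity hu.1 hu.2.1).integrableOn measurableSet_KR fun x _ => ?_
    have : 0 ≤ b * (‖D1 u x‖ ^ 2 + ‖D2 u x‖ ^ 2) := by positivity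
    simp only [glDensity]
    nlinarith [sq_nonneg (‖u x‖ ^ 2 - 1)]
  rw [setIntegral_const, volume_real_KR hR, smul_eq_mul, mul_comm] at h
  exact h

lemma m0_le (hb : 0 ≤ b) (hR : 0 ≤ R) {u : ℝ × ℝ → ℂ} (hu : IsTestFun R u) :
    m0 b R ≤ G2 b R u := by
  refine csInf_le ⟨-(1 / 2) * R ^ 2, ?_⟩ ⟨u, hu.1, hu.2.1, hu.2.2, rfl⟩
  rintro _ ⟨v, h1, h2, h3, rfl⟩
  exact neg_half_le_G2 hb hR ⟨h1, h2, h3⟩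

lemma le_m0 {a : ℝ} (h : ∀ u, IsTestFun R u → a ≤ G2 b R u) : a ≤ m0 b R := by
  obtain ⟨h1, h2, h3⟩ := isTestFun_zero (R := R)
  refine le_csInf ⟨_, 0, h1, h2, h3, rfl⟩ ?_
  rintro _ ⟨v, h1, h2, h3, rfl⟩
  exact h v ⟨h1, h2, h3⟩

lemma m0_nonpos (hb : 0 ≤ b) (hR : 0 ≤ R) : m0 b R ≤ 0 :=
  (m0_le hb hR isTestFun_zero).trans_eq G2_zero

/-- A square containing `n²` disjoint cells of side `r` has energy at most `n² m₀(b,r)`. -/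
lemma m0_le_sq_mul (hb : 0 ≤ b) {r : ℝ} (hr : 0 < r) {n : ℕ} (hn : n * r ≤ R) :
    m0 b R ≤ (n : ℝ) ^ 2 * m0 b r := by
  have hR : 0 ≤ R := le_trans (by positivity) hn
  rcases Nat.eq_zero_or_pos n with rfl | hn0
  · simpa using m0_nonpos hb hR
  have hn1 : (0 : ℝ) < (n : ℝ) ^ 2 := by positivity
  rw [← div_le_iff₀' hn1]
  refine le_m0 fun u hu => ?_
  rw [div_le_iff₀' hn1]
  let c : ℕ × ℕ → ℝ × ℝ := fun p =>
    (p.1 * r - (n - 1) * r / 2, p.2 * r - (n - 1) * r / 2)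
  have key : ∀ i j : ℕ, ∀ t d : ℝ, t - (i * r - d) ∈ Ioo (-r / 2) (r / 2) →
      t - (j * r - d) ∈ Ioo (-r / 2) (r / 2) → i ≤ j := by
    intro i j t d hi hj
    by_contra! hlt
    have : (j : ℝ) + 1 ≤ i := by exact_mod_cast hlt
    have := mul_le_mul_of_nonneg_right this hr.le
    linarith [hi.1, hj.2]
  have hd : Pairwise fun i j => Disjoint {x | x - c i ∈ KR r} {x | x - c j ∈ KR r} := by
    intro i j hij
    refine Set.disjoint_left.mpr fun x hi hj => hij (Prod.ext ?_ ?_)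
    · exact le_antisymm (key _ _ _ _ hi.1 hj.1) (key _ _ _ _ hj.1 hi.1)
    · exact le_antisymm (key _ _ _ _ hi.2 hj.2) (key _ _ _ _ hj.2 hi.2)
  obtain ⟨w, hw, hwc, hws, hwE⟩ := exists_superposition (b := b) hu.1 hu.2.1 hu.2.2 c hd
    (Finset.range n ×ˢ Finset.range n)
  have hcell : ∀ i : ℕ, i < n → ∀ t : ℝ,
      t - (i * r - (n - 1) * r / 2) ∈ Ioo (-r / 2) (r / 2) → t ∈ Ioo (-R / 2) (R / 2) := by
    intro i hi t ht
    have h1 : (i : ℝ) + 1 ≤ n := by exact_mod_cast hi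
    have h1 := mul_le_mul_of_nonneg_right h1 hr.le
    have h0 : 0 ≤ (i : ℝ) * r := by positivity
    constructor <;> linarith [ht.1, ht.2]
  have hwK : tsupport w ⊆ KR R := by
    refine hws.trans (Set.iUnion₂_subset fun i hi x hx => ?_)
    simp only [Finset.mem_product, Finset.mem_range] at hi
    exact ⟨hcell _ hi.1 _ hx.1, hcell _ hi.2 _ hx.2⟩
  refine (m0_le hb hR ⟨hw, hwc, hwK⟩).trans_eq ?_
  rw [G2_eq_integral hwK, hwE, G2_eq_integral hu.2.2]
  simp [sq]

lemma exists_tendsto_m0_div_sq (hb : 0 ≤ b) : ∃ L : ℝ,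
    Tendsto (fun R : ℝ => m0 b R / R ^ 2) atTop (nhds L) ∧ L ≤ 0 := by
  let f : ℝ → ℝ := fun R => m0 b R / R ^ 2
  have hbdd : BddBelow (f '' Ioi 0) := by
    refine ⟨-(1 / 2), ?_⟩
    rintro _ ⟨R, hR, rfl⟩
    have hR : 0 < R := hR
    rw [le_div_iff₀ (by positivity)]
    exact le_m0 fun u hu => neg_half_le_G2 hb hR.le hu
  have hne : (f '' Ioi 0).Nonempty := ⟨_, 1, Set.mem_Ioi.2 one_pos, rfl⟩
  have hlim : Tendsto f atTop (nhds (sInf (f '' Ioi 0))) := by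
    refine tendsto_order.mpr ⟨fun a ha => ?_, fun a ha => ?_⟩
    · filter_upwards [eventually_gt_atTop 0] with R hR
      exact ha.trans_le (csInf_le hbdd ⟨R, hR, rfl⟩)
    · obtain ⟨_, ⟨r, hr, rfl⟩, hra⟩ := exists_lt_of_csInf_lt hne ha
      have hr : 0 < r := hr
      have h1 : Tendsto (fun R : ℝ => (⌊r⁻¹ * R⌋₊ : ℝ) / R) atTop (nhds r⁻¹) :=
        tendsto_nat_floor_mul_div_atTop (by positivity)
      have h2 : Tendsto (fun R : ℝ => ((⌊r⁻¹ * R⌋₊ : ℝ) / R) ^ 2 * m0 b r) atTop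
          (nhds (f r)) := by
        have := (h1.pow 2).mul_const (m0 b r)
        convert this using 2
        simp only [f]
        field_simp
      filter_upwards [eventually_gt_atTop 0, h2.eventually_lt_const hra] with R hR hlt
      refine lt_of_le_of_lt ?_ hlt
      have hfl : (⌊r⁻¹ * R⌋₊ : ℝ) * r ≤ R := by
        have := Nat.floor_le (show 0 ≤ r⁻¹ * R by positivity)
        calc _ ≤ r⁻¹ * R * r := by gcongr
          _ = R := by field_simp
      have := m0_le_sq_mul hb hr hfl
      simp only [f]
      rw [div_pow, div_mul_eq_mul_div]
      gcongr
  refine ⟨_, hlim, le_of_tendsto hlim ?_⟩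
  filter_upwards [eventually_ge_atTop 0] with R hR
  exact div_nonpos_of_nonpos_of_nonneg (m0_nonpos hb hR) (by positivity)

end GroundState

section Landau

variable {u : ℝ × ℝ → ℂ}

/-- Integration by parts against a smooth compactly supported function. -/
lemma integral_mul_fderiv_of_hasCompactSupport {f g : ℝ × ℝ → ℝ} (hf : ContDiff ℝ (⊤ : ℕ∞) f)
    (hg : ContDiff ℝ (⊤ : ℕ∞) g) (hc : HasCompactSupport g) (v : ℝ × ℝ) :
    ∫ x, f x * fderiv ℝ g x v = - ∫ x, fderiv ℝ f x v * g x := by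
  have hf0 := hf.continuous
  have hg0 := hg.continuous
  have hf1 : Continuous (fderiv ℝ f) := hf.continuous_fderiv (by simp)
  have hg1 : Continuous (fderiv ℝ g) := hg.continuous_fderiv (by simp)
  refine integral_mul_fderiv_eq_neg_fderiv_mul_of_integrable ?_ ?_ ?_
    (fun x _ => hf.differentiable (by simp) x) (fun x _ => hg.differentiable (by simp) x)
  · exact Continuous.integrable_of_hasCompactSupport (by fun_prop) hc.mul_left
  · exact Continuous.integrable_of_hasCompactSupport (by fun_prop) (hc.fderiv_apply ℝ v).mul_left
  · exact Continuous.integrable_of_hasCompactSupport (by fun_prop) hc.mul_left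

lemma integral_jacobian_eq_zero {p q : ℝ × ℝ → ℝ} (hp : ContDiff ℝ (⊤ : ℕ∞) p)
    (hq : ContDiff ℝ (⊤ : ℕ∞) q) (hqc : HasCompactSupport q) (v w : ℝ × ℝ) :
    ∫ x, fderiv ℝ p x v * fderiv ℝ q x w = ∫ x, fderiv ℝ p x w * fderiv ℝ q x v := by
  have hd : ContDiff ℝ (⊤ : ℕ∞) (fderiv ℝ q) := hq.fderiv_right (by simp)
  have hdv : ∀ v, ContDiff ℝ (⊤ : ℕ∞) fun x => fderiv ℝ q x v := fun v =>
    hd.clm_apply contDiff_const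
  have hsnd : ∀ v w x, fderiv ℝ (fun x => fderiv ℝ q x v) x w = fderiv ℝ (fderiv ℝ q) x w v := by
    intro v w x
    rw [fderiv_clm_apply (hd.differentiable (by simp) x) (differentiableAt_const v)]
    simp
  have h1 := integral_mul_fderiv_of_hasCompactSupport hp (hdv w) (hqc.fderiv_apply ℝ w) v
  have h2 := integral_mul_fderiv_of_hasCompactSupport hp (hdv v) (hqc.fderiv_apply ℝ v) w
  have hsymm : ∀ x, fderiv ℝ (fderiv ℝ q) x v w = fderiv ℝ (fderiv ℝ q) x w v := fun x =>
    (hq.contDiffAt.isSymmSndFDerivAt (by simp; exact WithTop.coe_le_coe.2 le_top)).eq v w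
  simp only [hsnd, hsymm] at h1 h2
  linarith

/-- The part of `|(∇ - iA₀)u|² - |u|²` that integrates to zero. -/
noncomputable def landauDiv (u : ℝ × ℝ → ℂ) (x : ℝ × ℝ) : ℝ :=
  ‖D1 u x‖ ^ 2 + ‖D2 u x‖ ^ 2 - ‖u x‖ ^ 2 - ‖D1 u x + Complex.I * D2 u x‖ ^ 2

lemma continuous_landauDiv (hu : ContDiff ℝ (⊤ : ℕ∞) u) : Continuous (landauDiv u) := by
  have h0 := hu.continuous
  have h1 : Continuous (fderiv ℝ u) := hu.continuous_fderiv (by simp)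
  unfold landauDiv D1 D2 A0
  fun_prop

lemma hasCompactSupport_landauDiv (hc : HasCompactSupport u) :
    HasCompactSupport (landauDiv u) := by
  refine HasCompactSupport.intro hc fun x hx => ?_
  simp [landauDiv, D1, D2, image_eq_zero_of_notMem_tsupport hx, fderiv_of_notMem_tsupport ℝ hx]

lemma integral_landauDiv (hu : ContDiff ℝ (⊤ : ℕ∞) u) (hc : HasCompactSupport u) :
    ∫ x, landauDiv u x = 0 := by
  have hdu := hu.differentiable (by simp)
  let p : ℝ × ℝ → ℝ := fun x => (u x).re
  let q : ℝ × ℝ → ℝ := fun x => (u x).im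
  let g : ℝ × ℝ → ℝ := fun x => p x ^ 2 + q x ^ 2
  have hp : ContDiff ℝ (⊤ : ℕ∞) p := Complex.reCLM.contDiff.comp hu
  have hq : ContDiff ℝ (⊤ : ℕ∞) q := Complex.imCLM.contDiff.comp hu
  have hg : ContDiff ℝ (⊤ : ℕ∞) g := (hp.pow 2).add (hq.pow 2)
  have hpc : HasCompactSupport p := hc.comp_left (g := Complex.re) rfl
  have hqc : HasCompactSupport q := hc.comp_left (g := Complex.im) rfl
  have hgc : HasCompactSupport g := by
    refine hc.comp_left (g := fun z : ℂ => z.re ^ 2 + z.im ^ 2) (by simp)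
  have hdp : ∀ x v, fderiv ℝ p x v = (fderiv ℝ u x v).re := fun x v => by
    rw [show p = Complex.reCLM ∘ u from rfl, (Complex.reCLM.hasFDerivAt.comp x
      (hdu x).hasFDerivAt).fderiv]
    rfl
  have hdq : ∀ x v, fderiv ℝ q x v = (fderiv ℝ u x v).im := fun x v => by
    rw [show q = Complex.imCLM ∘ u from rfl, (Complex.imCLM.hasFDerivAt.comp x
      (hdu x).hasFDerivAt).fderiv]
    rfl
  have hdg : ∀ x v, fderiv ℝ g x v = 2 * (p x * fderiv ℝ p x v + q x * fderiv ℝ q x v) := by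
    intro x v
    have := ((hp.differentiable (by simp) x).hasFDerivAt.pow 2).add
      ((hq.differentiable (by simp) x).hasFDerivAt.pow 2)
    have h : HasFDerivAt g _ x := this
    rw [h.fderiv]
    simp
    ring
  have hp0 := hp.continuous
  have hq0 := hq.continuous
  have hg0 := hg.continuous
  have hp1 : Continuous (fderiv ℝ p) := hp.continuous_fderiv (by simp)
  have hq1 : Continuous (fderiv ℝ q) := hq.continuous_fderiv (by simp)
  have hg1 : Continuous (fderiv ℝ g) := hg.continuous_fderiv (by simp)
  have key : ∀ x, landauDiv u x =
      (2 * (fderiv ℝ p x (1, 0) * fderiv ℝ q x (0, 1))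
        - 2 * (fderiv ℝ p x (0, 1) * fderiv ℝ q x (1, 0)))
      - (x.1 * fderiv ℝ g x (1, 0) + x.2 * fderiv ℝ g x (0, 1) + 2 * g x) / 2 := by
    intro x
    simp only [hdg, hdp, hdq, landauDiv, D1, D2, A0, ← Complex.normSq_eq_norm_sq,
      Complex.normSq_apply, g, p, q]
    simp
    ring
  have hJ := integral_jacobian_eq_zero hp hq hqc (1, 0) (0, 1)
  have hx1 := integral_mul_fderiv_of_hasCompactSupport contDiff_fst hg hgc (1, 0)
  have hx2 := integral_mul_fderiv_of_hasCompactSupport contDiff_snd hg hgc (0, 1)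
  have e1 : ∀ x : ℝ × ℝ, fderiv ℝ (Prod.fst : ℝ × ℝ → ℝ) x (1, 0) = 1 := fun x => by
    simp [fderiv_fst]
  have e2 : ∀ x : ℝ × ℝ, fderiv ℝ (Prod.snd : ℝ × ℝ → ℝ) x (0, 1) = 1 := fun x => by
    simp [fderiv_snd]
  simp only [e1, e2, one_mul] at hx1 hx2
  have i1 : ∀ v w, Integrable fun x => fderiv ℝ p x v * fderiv ℝ q x w := fun v w =>
    Continuous.integrable_of_hasCompactSupport (by fun_prop) (hqc.fderiv_apply ℝ w).mul_left
  have i2 : Integrable fun x : ℝ × ℝ => x.1 * fderiv ℝ g x (1, 0) :=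
    Continuous.integrable_of_hasCompactSupport (by fun_prop) (hgc.fderiv_apply ℝ _).mul_left
  have i3 : Integrable fun x : ℝ × ℝ => x.2 * fderiv ℝ g x (0, 1) :=
    Continuous.integrable_of_hasCompactSupport (by fun_prop) (hgc.fderiv_apply ℝ _).mul_left
  have i4 : Integrable g := hg0.integrable_of_hasCompactSupport hgc
  have j1 : Integrable fun x : ℝ × ℝ => 2 * (fderiv ℝ p x (1, 0) * fderiv ℝ q x (0, 1))
      - 2 * (fderiv ℝ p x (0, 1) * fderiv ℝ q x (1, 0)) :=
    ((i1 _ _).const_mul 2).sub ((i1 _ _).const_mul 2)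
  have j2 : Integrable fun x : ℝ × ℝ =>
      x.1 * fderiv ℝ g x (1, 0) + x.2 * fderiv ℝ g x (0, 1) := i2.add i3
  have j3 : Integrable fun x : ℝ × ℝ =>
      (x.1 * fderiv ℝ g x (1, 0) + x.2 * fderiv ℝ g x (0, 1) + 2 * g x) / 2 :=
    (j2.add (i4.const_mul 2)).div_const 2
  simp only [key]
  rw [integral_sub j1 j3, integral_sub ((i1 _ _).const_mul 2) ((i1 _ _).const_mul 2),
    integral_div, integral_add j2 (i4.const_mul 2), integral_add i2 i3,
    integral_const_mul, integral_const_mul, integral_const_mul, hJ, hx1, hx2]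
  ring

lemma integral_glDensity_nonneg {b : ℝ} (hb : 1 ≤ b) (hu : ContDiff ℝ (⊤ : ℕ∞) u)
    (hc : HasCompactSupport u) : 0 ≤ ∫ x, glDensity b u x := by
  rw [← integral_landauDiv hu hc]
  refine integral_mono ((continuous_landauDiv hu).integrable_of_hasCompactSupport
    (hasCompactSupport_landauDiv hc)) (integrable_glDensity hu hc) fun x => ?_
  have h1 : 0 ≤ (b - 1) * (‖D1 u x‖ ^ 2 + ‖D2 u x‖ ^ 2) :=
    mul_nonneg (by linarith) (by positivity)
  have h2 : 0 ≤ ‖D1 u x + Complex.I * D2 u x‖ ^ 2 := by positivity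
  have h3 : 0 ≤ ‖u x‖ ^ 4 := by positivity
  simp only [landauDiv, glDensity]
  linarith

end Landau

/-- `m₀(b,R) = 0` for `b ≥ 1`, and the thermodynamic limit `g(b)` exists and is `≤ 0`. -/
theorem stmt_7 :
    (∀ b : ℝ, 1 ≤ b → ∀ R : ℝ, 0 < R → m0 b R = 0) ∧
    ∀ b : ℝ, 0 ≤ b → ∃ L : ℝ,
      Tendsto (fun R : ℝ => m0 b R / R ^ 2) atTop (nhds L) ∧ L ≤ 0 := by
  refine ⟨fun b hb R hR => ?_, fun b hb => exists_tendsto_m0_div_sq hb⟩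
  refine le_antisymm (m0_nonpos (by linarith) hR.le) (le_m0 fun u hu => ?_)
  rw [G2_eq_integral hu.2.2]
  exact integral_glDensity_nonneg hb hu.1 hu.2.1
end

section
/- The function g : [0,∞) → ℝ is continuous, nondecreasing and concave; moreover g(0) = −1/2, g(b) = 0 for all b ≥ 1, and the range of g is the interval [−1/2, 0]. -/
open MeasureTheory Filter Set

namespace GinzburgLandau

/-- Smooth functions with compact support inside `S`. -/
structure IsTest (S : Set (ℝ × ℝ)) (u : ℝ × ℝ → ℂ) : Prop where
  smooth : ContDiff ℝ (⊤ : ℕ∞) u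
  compact : HasCompactSupport u
  subset : tsupport u ⊆ S

/-- The magnetic kinetic energy density `|(∇ - iA₀)u|²`. -/
noncomputable def kin (u : ℝ × ℝ → ℂ) (x : ℝ × ℝ) : ℝ := ‖D1 u x‖ ^ 2 + ‖D2 u x‖ ^ 2

/-- The potential energy density `-|u|² + |u|⁴ / 2`. -/
noncomputable def pot (u : ℝ × ℝ → ℂ) (x : ℝ × ℝ) : ℝ := -‖u x‖ ^ 2 + (1/2) * ‖u x‖ ^ 4

variable {u v : ℝ × ℝ → ℂ} {S T : Set (ℝ × ℝ)} {x : ℝ × ℝ} {b R r : ℝ}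

lemma IsTest.mono (hu : IsTest S u) (h : S ⊆ T) : IsTest T u :=
  ⟨hu.smooth, hu.compact, hu.subset.trans h⟩

lemma isTest_zero : IsTest S (fun _ => 0) :=
  ⟨contDiff_const, HasCompactSupport.zero, by simp [tsupport]⟩

lemma KR_subset (h : r ≤ R) : KR r ⊆ KR R := by
  rintro x ⟨⟨h1, h2⟩, h3, h4⟩
  exact ⟨⟨by linarith, by linarith⟩, by linarith, by linarith⟩

lemma kin_congr (h : u =ᶠ[nhds x] v) : kin u x = kin v x := by
  simp only [kin, D1, D2, h.fderiv_eq, h.eq_of_nhds]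

lemma pot_congr (h : u =ᶠ[nhds x] v) : pot u x = pot v x := by
  simp only [pot, h.eq_of_nhds]

@[simp] lemma kin_zero : kin (fun _ => 0) x = 0 := by simp [kin, D1, D2]

@[simp] lemma pot_zero : pot (fun _ => 0) x = 0 := by simp [pot]

lemma kin_eq_zero (h : x ∉ tsupport u) : kin u x = 0 :=
  (kin_congr (notMem_tsupport_iff_eventuallyEq.mp h)).trans kin_zero

lemma pot_eq_zero (h : x ∉ tsupport u) : pot u x = 0 :=
  (pot_congr (notMem_tsupport_iff_eventuallyEq.mp h)).trans pot_zero

lemma kin_nonneg : 0 ≤ kin u x := by unfold kin; positivity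

lemma neg_half_le_pot : -(1/2) ≤ pot u x := by
  unfold pot; nlinarith [sq_nonneg (‖u x‖ ^ 2 - 1)]

lemma continuous_fderiv_apply (hu : ContDiff ℝ (⊤ : ℕ∞) u) (w : ℝ × ℝ) :
    Continuous fun x => fderiv ℝ u x w :=
  (hu.continuous_fderiv (by simp)).clm_apply continuous_const

lemma IsTest.integrable_kin (hu : IsTest S u) : Integrable (kin u) := by
  refine Continuous.integrable_of_hasCompactSupport ?_
    (HasCompactSupport.intro hu.compact fun x hx => kin_eq_zero hx)
  have h1 := continuous_fderiv_apply hu.smooth (1, 0)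
  have h2 := continuous_fderiv_apply hu.smooth (0, 1)
  have h3 := hu.smooth.continuous
  unfold kin D1 D2 A0
  fun_prop

lemma IsTest.integrable_pot (hu : IsTest S u) : Integrable (pot u) := by
  refine Continuous.integrable_of_hasCompactSupport ?_
    (HasCompactSupport.intro hu.compact fun x hx => pot_eq_zero hx)
  have h3 := hu.smooth.continuous
  unfold pot
  fun_prop

/-- The total kinetic energy. -/
noncomputable def kinE (u : ℝ × ℝ → ℂ) : ℝ := ∫ x, kin u x

/-- The total potential energy. -/
noncomputable def potE (u : ℝ × ℝ → ℂ) : ℝ := ∫ x, pot u x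

lemma kinE_nonneg : 0 ≤ kinE u := integral_nonneg fun _ => kin_nonneg

lemma IsTest.G2_eq (hu : IsTest (KR R) u) : G2 b R u = b * kinE u + potE u := by
  have h : G2 b R u = ∫ x in KR R, (b * kin u x + pot u x) := by
    unfold G2 kin pot
    congr 1; ext x; ring
  rw [h, setIntegral_eq_integral_of_forall_compl_eq_zero, integral_add, integral_const_mul]
  · rfl
  · exact hu.integrable_kin.const_mul b
  · exact hu.integrable_pot
  · intro x hx
    have hx' : x ∉ tsupport u := fun h => hx (hu.subset h)
    rw [kin_eq_zero hx', pot_eq_zero hx']; ring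

lemma measurableSet_KR : MeasurableSet (KR R) := measurableSet_Ioo.prod measurableSet_Ioo

lemma volume_KR (hR : 0 ≤ R) : volume.real (KR R) = R ^ 2 := by
  rw [KR, Measure.volume_eq_prod, measureReal_prod_prod, Real.volume_real_Ioo_of_le (by linarith)]
  ring

lemma volume_KR_ne_top : volume (KR R) ≠ ⊤ := by
  rw [KR, Measure.volume_eq_prod, Measure.prod_prod, Real.volume_Ioo]
  exact ENNReal.mul_ne_top ENNReal.ofReal_ne_top ENNReal.ofReal_ne_top

lemma IsTest.neg_half_le_potE (hR : 0 ≤ R) (hu : IsTest (KR R) u) :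
    -(1/2) * R ^ 2 ≤ potE u := by
  have h : potE u = ∫ x in KR R, pot u x :=
    (setIntegral_eq_integral_of_forall_compl_eq_zero fun x hx =>
      pot_eq_zero fun h => hx (hu.subset h)).symm
  have h2 : ∫ _ in KR R, (-(1/2) : ℝ) = -(1/2) * R ^ 2 := by
    rw [setIntegral_const, volume_KR hR, smul_eq_mul]; ring
  rw [h, ← h2]
  exact setIntegral_mono (integrableOn_const volume_KR_ne_top) hu.integrable_pot.integrableOn
    fun x => neg_half_le_pot

/-! ### Superposition of magnetic translates -/

lemma IsTest.add_of_disjoint (hu : IsTest S u) (hv : IsTest T v) (hST : Disjoint S T) :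
    IsTest (S ∪ T) (fun x => u x + v x) ∧
      kinE (fun x => u x + v x) = kinE u + kinE v ∧
      potE (fun x => u x + v x) = potE u + potE v := by
  have key : ∀ x, (x ∉ tsupport u) ∨ (x ∉ tsupport v) := fun x => by
    by_contra! h
    exact Set.disjoint_left.mp hST (hu.subset h.1) (hv.subset h.2)
  have hcases : ∀ x, ((fun y => u y + v y) =ᶠ[nhds x] v ∧ x ∉ tsupport u) ∨
      ((fun y => u y + v y) =ᶠ[nhds x] u ∧ x ∉ tsupport v) := fun x => by
    rcases key x with h | h
    · refine Or.inl ⟨?_, h⟩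
      filter_upwards [notMem_tsupport_iff_eventuallyEq.mp h] with y hy
      simp [hy]
    · refine Or.inr ⟨?_, h⟩
      filter_upwards [notMem_tsupport_iff_eventuallyEq.mp h] with y hy
      simp [hy]
  refine ⟨⟨hu.smooth.add hv.smooth, hu.compact.add hv.compact, ?_⟩, ?_, ?_⟩
  · exact (tsupport_add u v).trans (union_subset_union hu.subset hv.subset)
  · unfold kinE
    rw [← integral_add hu.integrable_kin hv.integrable_kin]
    congr 1; ext x
    rcases hcases x with ⟨h, h'⟩ | ⟨h, h'⟩
    · rw [kin_congr h, kin_eq_zero h', zero_add]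
    · rw [kin_congr h, kin_eq_zero h', add_zero]
  · unfold potE
    rw [← integral_add hu.integrable_pot hv.integrable_pot]
    congr 1; ext x
    rcases hcases x with ⟨h, h'⟩ | ⟨h, h'⟩
    · rw [pot_congr h, pot_eq_zero h', zero_add]
    · rw [pot_congr h, pot_eq_zero h', add_zero]

/-- The phase of the magnetic translation by `a`. -/
noncomputable def phase (a x : ℝ × ℝ) : ℂ :=
  Complex.exp (Complex.I * ((-a.2 * x.1 / 2 + a.1 * x.2 / 2 : ℝ) : ℂ))

/-- The magnetic translate of `u` by `a`. -/
noncomputable def translate (a : ℝ × ℝ) (u : ℝ × ℝ → ℂ) (x : ℝ × ℝ) : ℂ := phase a x * u (x - a)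

lemma norm_phase (a x : ℝ × ℝ) : ‖phase a x‖ = 1 := by
  rw [phase, mul_comm]; exact Complex.norm_exp_ofReal_mul_I _

lemma contDiff_phase (a : ℝ × ℝ) : ContDiff ℝ (⊤ : ℕ∞) (phase a) := by
  have h : ContDiff ℝ (⊤ : ℕ∞)
      fun x : ℝ × ℝ => ((-a.2 * x.1 / 2 + a.1 * x.2 / 2 : ℝ) : ℂ) :=
    Complex.ofRealCLM.contDiff.comp
      (f := fun x : ℝ × ℝ => -a.2 * x.1 / 2 + a.1 * x.2 / 2) (by fun_prop)
  exact (contDiff_const.mul h).cexp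

lemma fderiv_phase (a x w : ℝ × ℝ) : fderiv ℝ (phase a) x w =
    Complex.I * ((-a.2 * w.1 / 2 + a.1 * w.2 / 2 : ℝ) : ℂ) * phase a x := by
  let L : ℝ × ℝ →L[ℝ] ℝ :=
    (-a.2 / 2) • ContinuousLinearMap.fst ℝ ℝ ℝ + (a.1 / 2) • ContinuousLinearMap.snd ℝ ℝ ℝ
  have hL : ∀ y, -a.2 * y.1 / 2 + a.1 * y.2 / 2 = L y := fun y => by simp [L]; ring
  have h := (((Complex.ofRealCLM.comp L).hasFDerivAt (x := x)).const_mul Complex.I).cexp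
  have h' : phase a = fun y => Complex.exp (Complex.I * (Complex.ofRealCLM.comp L) y) := by
    ext y; simp only [phase, hL]; rfl
  rw [h', h.fderiv, hL]
  simp
  ring

lemma fderiv_translate (hu : ContDiff ℝ (⊤ : ℕ∞) u) (a x w : ℝ × ℝ) :
    fderiv ℝ (translate a u) x w = phase a x * (fderiv ℝ u (x - a) w +
      Complex.I * ((-a.2 * w.1 / 2 + a.1 * w.2 / 2 : ℝ) : ℂ) * u (x - a)) := by
  have h1 : DifferentiableAt ℝ (phase a) x := (contDiff_phase a).differentiable (by simp) x
  have h2 : DifferentiableAt ℝ (fun y => u (y - a)) x :=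
    (hu.comp (contDiff_id.sub contDiff_const)).differentiable (by simp) x
  have h3 : fderiv ℝ (fun y => u (y - a)) x = fderiv ℝ u (x - a) := fderiv_comp_sub a
  have h : translate a u = fun y => phase a y * u (y - a) := rfl
  rw [h, fderiv_fun_mul h1 h2, h3]
  simp only [add_apply, smul_apply, smul_eq_mul,
    fderiv_phase]
  ring

lemma kin_translate (hu : ContDiff ℝ (⊤ : ℕ∞) u) (a x : ℝ × ℝ) :
    kin (translate a u) x = kin u (x - a) := by
  have h1 : D1 (translate a u) x = phase a x * D1 u (x - a) := by
    simp only [D1, fderiv_translate hu, A0, translate, Prod.fst_sub, Prod.snd_sub]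
    push_cast; ring
  have h2 : D2 (translate a u) x = phase a x * D2 u (x - a) := by
    simp only [D2, fderiv_translate hu, A0, translate, Prod.fst_sub, Prod.snd_sub]
    push_cast; ring
  simp [kin, h1, h2, norm_phase]

lemma pot_translate (a x : ℝ × ℝ) : pot (translate a u) x = pot u (x - a) := by
  simp [pot, translate, norm_phase]

lemma IsTest.translate (hu : IsTest S u) (a : ℝ × ℝ) :
    IsTest {x | x - a ∈ S} (translate a u) := by
  have h : HasCompactSupport (fun x => u (x - a)) := hu.compact.comp_homeomorph (.subRight a)
  refine ⟨(contDiff_phase a).mul (hu.smooth.comp (contDiff_id.sub contDiff_const)),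
    h.mul_left, ?_⟩
  refine (tsupport_mul_subset_right (f := phase a) (g := fun x => u (x - a))).trans ?_
  intro x hx
  rw [show (fun x => u (x - a)) = u ∘ (Homeomorph.subRight a) from rfl,
    tsupport_comp_eq_preimage] at hx
  exact hu.subset hx

lemma kinE_translate (hu : ContDiff ℝ (⊤ : ℕ∞) u) (a : ℝ × ℝ) :
    kinE (translate a u) = kinE u := by
  simp only [kinE, kin_translate hu]
  exact integral_sub_right_eq_self (kin u) a

lemma potE_translate (a : ℝ × ℝ) : potE (translate a u) = potE u := by
  simp only [potE, pot_translate]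
  exact integral_sub_right_eq_self (pot u) a

lemma IsTest.exists_superposition {ι : Type*} (hu : IsTest S u) (a : ι → ℝ × ℝ)
    (ha : Pairwise fun i j => Disjoint {x | x - a i ∈ S} {x | x - a j ∈ S}) (s : Finset ι) :
    ∃ v, IsTest (⋃ i ∈ s, {x | x - a i ∈ S}) v ∧
      kinE v = s.card * kinE u ∧ potE v = s.card * potE u := by
  classical
  induction s using Finset.induction_on with
  | empty => exact ⟨fun _ => 0, isTest_zero, by simp [kinE], by simp [potE]⟩
  | insert i s hi ih =>
    obtain ⟨v, hv, hk, hp⟩ := ih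
    have hd : Disjoint {x | x - a i ∈ S} (⋃ j ∈ s, {x | x - a j ∈ S}) := by
      simp only [Set.disjoint_iUnion_right]
      exact fun j hj => ha fun hij => hi (hij ▸ hj)
    obtain ⟨h1, h2, h3⟩ := (hu.translate (a i)).add_of_disjoint hv hd
    refine ⟨_, h1.mono (by simp), ?_, ?_⟩
    · rw [h2, hk, kinE_translate hu.smooth, Finset.card_insert_of_notMem hi]; push_cast; ring
    · rw [h3, hp, potE_translate, Finset.card_insert_of_notMem hi]; push_cast; ring

lemma IsTest.exists_tiling (hr : 0 < r) (hu : IsTest (KR r) u) (N : ℕ) :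
    ∃ v, IsTest (KR (N * r)) v ∧ kinE v = N ^ 2 * kinE u ∧ potE v = N ^ 2 * potE u := by
  let a : ℕ × ℕ → ℝ × ℝ := fun i => (r * (i.1 - (N - 1) / 2), r * (i.2 - (N - 1) / 2))
  have hlt : ∀ m n : ℕ, m < n → r * m + r ≤ r * n := fun m n h => by
    have : (m : ℝ) + 1 ≤ n := by exact_mod_cast h
    nlinarith
  have ha : Pairwise fun i j => Disjoint {x | x - a i ∈ KR r} {x | x - a j ∈ KR r} := by
    intro i j hij
    refine Set.disjoint_left.mpr ?_
    rintro x ⟨⟨h1, h2⟩, h3, h4⟩ ⟨⟨h5, h6⟩, h7, h8⟩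
    simp only [a, Prod.fst_sub, Prod.snd_sub] at h1 h2 h3 h4 h5 h6 h7 h8
    refine hij (Prod.ext ?_ ?_)
    · by_contra hne
      rcases Nat.lt_or_gt_of_ne hne with h | h
      · linarith [hlt _ _ h]
      · linarith [hlt _ _ h]
    · by_contra hne
      rcases Nat.lt_or_gt_of_ne hne with h | h
      · linarith [hlt _ _ h]
      · linarith [hlt _ _ h]
  obtain ⟨v, hv, hk, hp⟩ := hu.exists_superposition a ha (Finset.range N ×ˢ Finset.range N)
  refine ⟨v, hv.mono ?_, ?_, ?_⟩
  · simp only [Set.iUnion_subset_iff, Finset.mem_product, Finset.mem_range]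
    rintro i ⟨hi, hj⟩ x ⟨⟨h1, h2⟩, h3, h4⟩
    simp only [a, Prod.fst_sub, Prod.snd_sub] at h1 h2 h3 h4
    have e1 := hlt _ _ hi
    have e2 := hlt _ _ hj
    have e3 : 0 ≤ r * i.1 := by positivity
    have e4 : 0 ≤ r * i.2 := by positivity
    exact ⟨⟨by linarith, by linarith⟩, by linarith, by linarith⟩
  · rw [hk, Finset.card_product, Finset.card_range]; push_cast; ring
  · rw [hp, Finset.card_product, Finset.card_range]; push_cast; ring

/-! ### The thermodynamic limit as an infimum -/

/-- The energies per unit area of all test functions on all squares. -/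
def energySet (b : ℝ) : Set ℝ :=
  {e | ∃ r : ℝ, 0 < r ∧ ∃ u, IsTest (KR r) u ∧ e = (b * kinE u + potE u) / r ^ 2}

lemma neg_half_le_energy (hb : 0 ≤ b) (hr : 0 < r) (hu : IsTest (KR r) u) :
    -(1/2) ≤ (b * kinE u + potE u) / r ^ 2 := by
  rw [le_div_iff₀ (by positivity)]
  have := mul_nonneg hb (kinE_nonneg (u := u))
  linarith [hu.neg_half_le_potE hr.le]

lemma bddBelow_energySet (hb : 0 ≤ b) : BddBelow (energySet b) :=
  ⟨-(1/2), by rintro _ ⟨r, hr, u, hu, rfl⟩; exact neg_half_le_energy hb hr hu⟩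

lemma nonempty_energySet : (energySet b).Nonempty :=
  ⟨_, 1, one_pos, fun _ => 0, isTest_zero, rfl⟩

lemma m0_le (hb : 0 ≤ b) (hR : 0 ≤ R) (hu : IsTest (KR R) u) : m0 b R ≤ b * kinE u + potE u := by
  refine csInf_le ⟨-(1/2) * R ^ 2, ?_⟩ ⟨u, hu.smooth, hu.compact, hu.subset, hu.G2_eq.symm⟩
  rintro _ ⟨v, h1, h2, h3, rfl⟩
  have hv : IsTest (KR R) v := ⟨h1, h2, h3⟩
  rw [hv.G2_eq]
  have := mul_nonneg hb (kinE_nonneg (u := v))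
  linarith [hv.neg_half_le_potE hR]

lemma le_m0 {c : ℝ} (h : ∀ u, IsTest (KR R) u → c ≤ b * kinE u + potE u) : c ≤ m0 b R := by
  have h0 : IsTest (KR R) fun _ => 0 := isTest_zero
  refine le_csInf ⟨_, _, h0.smooth, h0.compact, h0.subset, rfl⟩ ?_
  rintro _ ⟨v, h1, h2, h3, rfl⟩
  have hv : IsTest (KR R) v := ⟨h1, h2, h3⟩
  rw [hv.G2_eq]
  exact h v hv

lemma tendsto_m0_div (hb : 0 ≤ b) :
    Tendsto (fun R : ℝ => m0 b R / R ^ 2) atTop (nhds (sInf (energySet b))) := by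
  refine tendsto_order.mpr ⟨fun c hc => ?_, fun c hc => ?_⟩
  · filter_upwards [eventually_gt_atTop 0] with R hR
    refine hc.trans_le ?_
    rw [le_div_iff₀ (by positivity)]
    refine le_m0 fun u hu => ?_
    rw [← le_div_iff₀ (by positivity)]
    exact csInf_le (bddBelow_energySet hb) ⟨R, hR, u, hu, rfl⟩
  · obtain ⟨_, ⟨r, hr, u, hu, rfl⟩, he⟩ := exists_lt_of_csInf_lt nonempty_energySet hc
    have hlim : Tendsto (fun R : ℝ => ((⌊r⁻¹ * R⌋₊ : ℝ) / R) ^ 2 * (b * kinE u + potE u)) atTop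
        (nhds ((b * kinE u + potE u) / r ^ 2)) := by
      have h := ((tendsto_nat_floor_mul_div_atTop (R := ℝ) (inv_nonneg.mpr hr.le)).pow 2).mul_const
        (b * kinE u + potE u)
      rwa [inv_pow, inv_mul_eq_div] at h
    filter_upwards [eventually_gt_atTop 0, hlim.eventually_lt_const he] with R hR hlt
    refine lt_of_le_of_lt ?_ hlt
    obtain ⟨v, hv, hk, hp⟩ := hu.exists_tiling hr ⌊r⁻¹ * R⌋₊
    have hle : (⌊r⁻¹ * R⌋₊ : ℝ) * r ≤ R := by
      rw [← le_div_iff₀ hr, ← inv_mul_eq_div]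
      exact Nat.floor_le (by positivity)
    have h := m0_le hb hR.le (hv.mono (KR_subset hle))
    rw [hk, hp] at h
    rw [div_le_iff₀ (by positivity), div_pow]
    calc m0 b R ≤ _ := h
      _ = _ := by field_simp

lemma gfun_eq_sInf (hb : 0 ≤ b) : gfun b = sInf (energySet b) :=
  (tendsto_m0_div hb).limUnder_eq

lemma gfun_le (hb : 0 ≤ b) (hr : 0 < r) (hu : IsTest (KR r) u) :
    gfun b ≤ (b * kinE u + potE u) / r ^ 2 := by
  rw [gfun_eq_sInf hb]
  exact csInf_le (bddBelow_energySet hb) ⟨r, hr, u, hu, rfl⟩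

lemma le_gfun {c : ℝ} (hb : 0 ≤ b)
    (h : ∀ r, 0 < r → ∀ u, IsTest (KR r) u → c ≤ (b * kinE u + potE u) / r ^ 2) : c ≤ gfun b := by
  rw [gfun_eq_sInf hb]
  refine le_csInf nonempty_energySet ?_
  rintro _ ⟨r, hr, u, hu, rfl⟩
  exact h r hr u hu

lemma neg_half_le_gfun (hb : 0 ≤ b) : -(1/2) ≤ gfun b :=
  le_gfun hb fun _ hr _ hu => neg_half_le_energy hb hr hu

lemma gfun_nonpos (hb : 0 ≤ b) : gfun b ≤ 0 := by
  simpa [kinE, potE] using gfun_le hb one_pos (isTest_zero (S := KR 1))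

lemma monotoneOn_gfun : MonotoneOn gfun (Ici 0) := by
  intro b hb c hc hbc
  refine le_gfun hc fun r hr u hu => (gfun_le hb hr hu).trans ?_
  have := kinE_nonneg (u := u)
  gcongr

lemma concaveOn_gfun : ConcaveOn ℝ (Ici 0) gfun := by
  refine ⟨convex_Ici 0, fun b hb c hc s t hs ht hst => ?_⟩
  refine le_gfun ((convex_Ici (0 : ℝ)) hb hc hs ht hst) fun r hr u hu => ?_
  calc s • gfun b + t • gfun c
      ≤ s * ((b * kinE u + potE u) / r ^ 2) + t * ((c * kinE u + potE u) / r ^ 2) := by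
        have h1 := gfun_le hb hr hu
        have h2 := gfun_le hc hr hu
        simp only [smul_eq_mul]
        gcongr
    _ = ((s * b + t * c) * kinE u + (s + t) * potE u) / r ^ 2 := by ring
    _ = _ := by rw [hst, one_mul]; simp only [smul_eq_mul]

lemma exists_isTest_potE_lt {ε : ℝ} (hε : 0 < ε) :
    ∃ u, IsTest (KR 1) u ∧ potE u < -(1/2) + ε := by
  obtain ⟨δ, hδ0, hδ1, hδ⟩ : ∃ δ : ℝ, 0 < δ ∧ δ < 1 / 4 ∧ 2 * δ ≤ ε / 2 :=
    ⟨min (1/8) (ε/4), by positivity, by linarith [min_le_left (1/8) (ε/4)],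
      by linarith [min_le_right (1/8) (ε/4)]⟩
  let f : ContDiffBump (0 : ℝ × ℝ) := ⟨1/2 - δ, 1/2 - δ/2, by linarith, by linarith⟩
  let u : ℝ × ℝ → ℂ := fun x => (f x : ℂ)
  have hts : tsupport u ⊆ tsupport f :=
    closure_mono fun x hx => by simpa [u] using hx
  have hu : IsTest (KR 1) u := by
    refine ⟨Complex.ofRealCLM.contDiff.comp f.contDiff,
      f.hasCompactSupport.of_isClosed_subset (isClosed_tsupport _) hts, hts.trans ?_⟩
    rw [f.tsupport_eq]
    intro x hx
    have h1 := (norm_fst_le x).trans (mem_closedBall_zero_iff.mp hx)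
    have h2 := (norm_snd_le x).trans (mem_closedBall_zero_iff.mp hx)
    rw [Real.norm_eq_abs, abs_le] at h1 h2
    simp only [f] at h1 h2
    exact ⟨⟨by linarith, by linarith⟩, by linarith, by linarith⟩
  refine ⟨u, hu, ?_⟩
  have hnorm : ∀ x, ‖u x‖ = f x := fun x => by
    simp [u, abs_of_nonneg f.nonneg]
  have hle : ∀ x, pot u x ≤ (KR (1 - 2 * δ)).indicator (fun _ => (-(1/2) : ℝ)) x := fun x => by
    have h0 := f.nonneg (x := x)
    have h1 := f.le_one (x := x)
    by_cases hx : x ∈ KR (1 - 2 * δ)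
    · rw [indicator_of_mem hx]
      have : f x = 1 := by
        refine f.one_of_mem_closedBall (mem_closedBall_zero_iff.mpr ?_)
        obtain ⟨⟨a1, a2⟩, a3, a4⟩ := hx
        refine norm_prod_le_iff.mpr ⟨?_, ?_⟩ <;> rw [Real.norm_eq_abs, abs_le] <;>
          simp only [f] <;> constructor <;> linarith
      rw [pot, hnorm, this]; norm_num
    · rw [indicator_of_notMem hx, pot, hnorm]
      nlinarith [pow_le_one₀ h0 h1 (n := 2), sq_nonneg (f x)]
  have hint : ∫ x, (KR (1 - 2 * δ)).indicator (fun _ => (-(1/2) : ℝ)) x =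
      -(1/2) * (1 - 2 * δ) ^ 2 := by
    rw [integral_indicator measurableSet_KR, setIntegral_const, volume_KR (by linarith),
      smul_eq_mul]
    ring
  have : potE u ≤ -(1/2) * (1 - 2 * δ) ^ 2 := by
    rw [← hint]
    exact integral_mono hu.integrable_pot
      ((integrableOn_const volume_KR_ne_top).integrable_indicator measurableSet_KR) hle
  nlinarith

lemma gfun_zero : gfun 0 = -(1/2) := by
  refine le_antisymm (le_of_forall_pos_le_add fun ε hε => ?_) (neg_half_le_gfun le_rfl)
  obtain ⟨u, hu, h⟩ := exists_isTest_potE_lt hε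
  have := gfun_le le_rfl one_pos hu
  norm_num at this h ⊢
  linarith

lemma continuousOn_gfun : ContinuousOn gfun (Ici 0) := by
  intro b hb
  rcases eq_or_lt_of_le (mem_Ici.mp hb) with rfl | hb
  · rw [ContinuousWithinAt, gfun_zero]
    refine tendsto_order.mpr ⟨fun c hc => ?_, fun c hc => ?_⟩
    · filter_upwards [self_mem_nhdsWithin] with b hb
      exact hc.trans_le (neg_half_le_gfun hb)
    · obtain ⟨u, hu, h⟩ := exists_isTest_potE_lt (sub_pos.mpr hc)
      have hlim : Tendsto (fun b : ℝ => (b * kinE u + potE u) / 1 ^ 2) (nhdsWithin 0 (Ici 0))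
          (nhds ((0 * kinE u + potE u) / 1 ^ 2)) :=
        tendsto_nhdsWithin_of_tendsto_nhds (Continuous.tendsto (by fun_prop) 0)
      have hlt : (0 * kinE u + potE u) / 1 ^ 2 < c := by norm_num at h ⊢; linarith
      filter_upwards [self_mem_nhdsWithin, hlim.eventually_lt_const hlt] with b hb hbc
      exact (gfun_le hb one_pos hu).trans_lt hbc
  · have h := concaveOn_gfun.continuousOn_interior
    rw [interior_Ici] at h
    exact (h.continuousAt (Ioi_mem_nhds hb)).continuousWithinAt

/-! ### The lower bound for the magnetic Laplacian -/

lemma integral_fderiv_eq_zero {F : ℝ × ℝ → ℝ} (hF : ContDiff ℝ 1 F) (hc : HasCompactSupport F)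
    (w : ℝ × ℝ) : ∫ x, fderiv ℝ F x w = 0 := by
  have h1 : Integrable F := hF.continuous.integrable_of_hasCompactSupport hc
  have h2 : Integrable fun x => fderiv ℝ F x w :=
    ((hF.continuous_fderiv (by simp)).clm_apply continuous_const).integrable_of_hasCompactSupport
      (hc.fderiv_apply ℝ w)
  have := integral_mul_fderiv_eq_neg_fderiv_mul_of_integrable (μ := volume)
    (f := fun _ : ℝ × ℝ => (1 : ℝ)) (g := F) (v := w)
    (by simp) (by simpa using h2) (by simpa using h1)
    (fun x _ => by fun_prop) (fun x _ => hF.differentiable (by simp) x)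
  simpa using this

/-- The component `Re u ∂_w Im u - Im u ∂_w Re u` of the current, for `u = p + i q`. -/
noncomputable def current (p q : ℝ × ℝ → ℝ) (w x : ℝ × ℝ) : ℝ :=
  p x * fderiv ℝ q x w - q x * fderiv ℝ p x w

lemma contDiff_fderiv_apply {p : ℝ × ℝ → ℝ} (hp : ContDiff ℝ (⊤ : ℕ∞) p) (w : ℝ × ℝ) :
    ContDiff ℝ (⊤ : ℕ∞) fun x => fderiv ℝ p x w :=
  (hp.fderiv_right (by simp)).clm_apply contDiff_const

lemma fderiv_fderiv_apply {p : ℝ × ℝ → ℝ} (hp : ContDiff ℝ (⊤ : ℕ∞) p) (x w z : ℝ × ℝ) :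
    fderiv ℝ (fun y => fderiv ℝ p y w) x z = fderiv ℝ (fderiv ℝ p) x z w := by
  have h : ContDiff ℝ (⊤ : ℕ∞) (fderiv ℝ p) := hp.fderiv_right (by simp)
  rw [fderiv_clm_apply (h.differentiable (by simp) x) (differentiableAt_const w)]
  simp

lemma fderiv_current {p q : ℝ × ℝ → ℝ} (hp : ContDiff ℝ (⊤ : ℕ∞) p)
    (hq : ContDiff ℝ (⊤ : ℕ∞) q) (x w z : ℝ × ℝ) :
    fderiv ℝ (current p q w) x z =
      fderiv ℝ p x z * fderiv ℝ q x w + p x * fderiv ℝ (fderiv ℝ q) x z w -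
        (fderiv ℝ q x z * fderiv ℝ p x w + q x * fderiv ℝ (fderiv ℝ p) x z w) := by
  have dp := hp.differentiable (by simp) x
  have dq := hq.differentiable (by simp) x
  have dp' := (contDiff_fderiv_apply hp w).differentiable (by simp) x
  have dq' := (contDiff_fderiv_apply hq w).differentiable (by simp) x
  have h : current p q w = fun x => p x * fderiv ℝ q x w - q x * fderiv ℝ p x w := rfl
  rw [h, fderiv_fun_sub (dp.fun_mul dq') (dq.fun_mul dp'), fderiv_fun_mul dp dq',
    fderiv_fun_mul dq dp']
  simp only [sub_apply, add_apply, smul_apply, smul_eq_mul, fderiv_fderiv_apply hp,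
    fderiv_fderiv_apply hq]
  ring

lemma IsTest.integrable_normSq (hu : IsTest S u) : Integrable fun x => ‖u x‖ ^ 2 := by
  refine Continuous.integrable_of_hasCompactSupport (hu.smooth.continuous.norm.pow 2)
    (HasCompactSupport.intro hu.compact fun x hx => ?_)
  simp [image_eq_zero_of_notMem_tsupport hx]

lemma IsTest.integral_normSq_le_kinE (hu : IsTest S u) : ∫ x, ‖u x‖ ^ 2 ≤ kinE u := by
  let p : ℝ × ℝ → ℝ := fun x => (u x).re
  let q : ℝ × ℝ → ℝ := fun x => (u x).im
  have hp : ContDiff ℝ (⊤ : ℕ∞) p := Complex.reCLM.contDiff.comp hu.smooth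
  have hq : ContDiff ℝ (⊤ : ℕ∞) q := Complex.imCLM.contDiff.comp hu.smooth
  have du : ∀ x, DifferentiableAt ℝ u x := fun x => hu.smooth.differentiable (by simp) x
  have hp' : ∀ x w, fderiv ℝ p x w = (fderiv ℝ u x w).re := fun x w => by
    rw [show p = Complex.reCLM ∘ u from rfl,
      (Complex.reCLM.hasFDerivAt.comp x (du x).hasFDerivAt).fderiv]; rfl
  have hq' : ∀ x w, fderiv ℝ q x w = (fderiv ℝ u x w).im := fun x w => by
    rw [show q = Complex.imCLM ∘ u from rfl,
      (Complex.imCLM.hasFDerivAt.comp x (du x).hasFDerivAt).fderiv]; rfl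
  let F₁ : ℝ × ℝ → ℝ := fun x => current p q (0, 1) x - x.1 / 2 * (p x ^ 2 + q x ^ 2)
  let F₂ : ℝ × ℝ → ℝ := fun x => current p q (1, 0) x + x.2 / 2 * (p x ^ 2 + q x ^ 2)
  have hcur : ∀ w, ContDiff ℝ (⊤ : ℕ∞) (current p q w) := fun w =>
    (hp.mul (contDiff_fderiv_apply hq w)).sub (hq.mul (contDiff_fderiv_apply hp w))
  have hF₁ : ContDiff ℝ (⊤ : ℕ∞) F₁ := by fun_prop
  have hF₂ : ContDiff ℝ (⊤ : ℕ∞) F₂ := by fun_prop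
  have hp0 : ∀ x ∉ tsupport u, p x = 0 := fun x hx => by
    simp [p, image_eq_zero_of_notMem_tsupport hx]
  have hq0 : ∀ x ∉ tsupport u, q x = 0 := fun x hx => by
    simp [q, image_eq_zero_of_notMem_tsupport hx]
  have hc₁ : HasCompactSupport F₁ := HasCompactSupport.intro hu.compact fun x hx => by
    simp [F₁, current, hp0 x hx, hq0 x hx]
  have hc₂ : HasCompactSupport F₂ := HasCompactSupport.intro hu.compact fun x hx => by
    simp [F₂, current, hp0 x hx, hq0 x hx]
  have i₁ : Integrable fun x => fderiv ℝ F₁ x (1, 0) :=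
    (contDiff_fderiv_apply hF₁ _).continuous.integrable_of_hasCompactSupport (hc₁.fderiv_apply ℝ _)
  have i₂ : Integrable fun x => fderiv ℝ F₂ x (0, 1) :=
    (contDiff_fderiv_apply hF₂ _).continuous.integrable_of_hasCompactSupport (hc₂.fderiv_apply ℝ _)
  have i₁₂ : Integrable fun x => fderiv ℝ F₁ x (1, 0) - fderiv ℝ F₂ x (0, 1) := i₁.sub i₂
  have e₁ : ∀ x, fderiv ℝ F₁ x (1, 0) = fderiv ℝ (current p q (0, 1)) x (1, 0) -
      (1 / 2 * (p x ^ 2 + q x ^ 2) +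
        x.1 * (p x * fderiv ℝ p x (1, 0) + q x * fderiv ℝ q x (1, 0))) := fun x => by
    have dp := (hp.differentiable (by simp) x).hasFDerivAt
    have dq := (hq.differentiable (by simp) x).hasFDerivAt
    have dc := ((hcur (0, 1)).differentiable (by simp) x).hasFDerivAt
    have h := dc.sub (((hasFDerivAt_fst (𝕜 := ℝ) (p := x)).mul_const (1/2)).mul
      ((dp.mul dp).add (dq.mul dq)))
    have hF : F₁ = current p q (0, 1) - (fun x => x.1 * (1/2)) * (p * p + q * q) := by
      ext x; simp [F₁]; ring
    rw [hF]
    erw [h.fderiv]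
    simp
    ring
  have e₂ : ∀ x, fderiv ℝ F₂ x (0, 1) = fderiv ℝ (current p q (1, 0)) x (0, 1) +
      (1 / 2 * (p x ^ 2 + q x ^ 2) +
        x.2 * (p x * fderiv ℝ p x (0, 1) + q x * fderiv ℝ q x (0, 1))) := fun x => by
    have dp := (hp.differentiable (by simp) x).hasFDerivAt
    have dq := (hq.differentiable (by simp) x).hasFDerivAt
    have dc := ((hcur (1, 0)).differentiable (by simp) x).hasFDerivAt
    have h := dc.add (((hasFDerivAt_snd (𝕜 := ℝ) (p := x)).mul_const (1/2)).mul
      ((dp.mul dp).add (dq.mul dq)))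
    have hF : F₂ = current p q (1, 0) + (fun x => x.2 * (1/2)) * (p * p + q * q) := by
      ext x; simp [F₂]; ring
    rw [hF]
    erw [h.fderiv]
    simp
    ring
  have hle : ∀ x, ‖u x‖ ^ 2 + (fderiv ℝ F₁ x (1, 0) - fderiv ℝ F₂ x (0, 1)) ≤ kin u x := fun x => by
    have h2 : minSmoothness ℝ 2 ≤ ((⊤ : ℕ∞) : WithTop ℕ∞) := by
      rw [minSmoothness_of_isRCLikeNormedField]; exact WithTop.coe_le_coe.mpr le_top
    have sp : fderiv ℝ (fderiv ℝ p) x (0, 1) (1, 0) = fderiv ℝ (fderiv ℝ p) x (1, 0) (0, 1) :=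
      (hp.contDiffAt.isSymmSndFDerivAt h2) _ _
    have sq : fderiv ℝ (fderiv ℝ q) x (0, 1) (1, 0) = fderiv ℝ (fderiv ℝ q) x (1, 0) (0, 1) :=
      (hq.contDiffAt.isSymmSndFDerivAt h2) _ _
    rw [e₁, e₂, fderiv_current hp hq, fderiv_current hp hq, sp, sq]
    simp only [hp', hq', kin, Complex.sq_norm, Complex.normSq_apply, D1, D2, A0, p, q]
    generalize fderiv ℝ u x (1, 0) = a
    generalize fderiv ℝ u x (0, 1) = c
    simp
    nlinarith [sq_nonneg ((a.re - (x.2 / 2 * (u x).im)) - (c.im - (x.1 / 2 * (u x).re))),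
      sq_nonneg ((a.im + (x.2 / 2 * (u x).re)) + (c.re + (x.1 / 2 * (u x).im)))]
  have hmono : ∫ x, (‖u x‖ ^ 2 + (fderiv ℝ F₁ x (1, 0) - fderiv ℝ F₂ x (0, 1))) ≤ ∫ x, kin u x :=
    integral_mono (hu.integrable_normSq.add i₁₂) hu.integrable_kin hle
  rw [integral_add hu.integrable_normSq i₁₂, integral_sub i₁ i₂,
    integral_fderiv_eq_zero (hF₁.of_le (by simp)) hc₁,
    integral_fderiv_eq_zero (hF₂.of_le (by simp)) hc₂] at hmono
  simpa [kinE] using hmono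

lemma gfun_eq_zero_of_one_le (hb : 1 ≤ b) : gfun b = 0 := by
  have hb0 : 0 ≤ b := by linarith
  refine le_antisymm (gfun_nonpos hb0) (le_gfun hb0 fun r hr u hu => div_nonneg ?_ (by positivity))
  have hk := hu.integral_normSq_le_kinE
  have hp : -∫ x, ‖u x‖ ^ 2 ≤ potE u := by
    rw [← integral_neg]
    refine integral_mono hu.integrable_normSq.neg hu.integrable_pot fun x => ?_
    simp only [pot]
    have : 0 ≤ ‖u x‖ ^ 4 := by positivity
    linarith
  nlinarith [kinE_nonneg (u := u)]

lemma image_gfun : gfun '' Ici 0 = Icc (-(1/2)) 0 := by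
  refine Subset.antisymm ?_ fun y hy => ?_
  · rintro _ ⟨b, hb, rfl⟩
    exact ⟨neg_half_le_gfun hb, gfun_nonpos hb⟩
  · have h := intermediate_value_Icc zero_le_one (continuousOn_gfun.mono Icc_subset_Ici_self)
    rw [gfun_zero, gfun_eq_zero_of_one_le le_rfl] at h
    exact image_mono Icc_subset_Ici_self (h hy)

end GinzburgLandau

/-- Properties of the limit function `g`: continuity, monotonicity, concavity,
boundary values and range. -/
theorem stmt_8 :
    ContinuousOn gfun (Ici 0) ∧
    MonotoneOn gfun (Ici 0) ∧
    ConcaveOn ℝ (Ici 0) gfun ∧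
    gfun 0 = -(1/2) ∧
    (∀ b : ℝ, 1 ≤ b → gfun b = 0) ∧
    gfun '' (Ici 0) = Icc (-(1/2)) 0 :=
  ⟨GinzburgLandau.continuousOn_gfun, GinzburgLandau.monotoneOn_gfun,
    GinzburgLandau.concaveOn_gfun, GinzburgLandau.gfun_zero,
    fun _ => GinzburgLandau.gfun_eq_zero_of_one_le, GinzburgLandau.image_gfun⟩
end
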